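/- The element i_1^0 i_2^0 ⋯ i_ν^0 of 𝒰(K_+) is the same for all reduced words (i_1,…,i_ν) of w₀; denote it 𝐇. Moreover 𝐇 is the unique element H of 𝒰(K_+) such that χ_{w₀}(H) = g_{j_1} g_{j_2} ⋯ g_{j_ν} in 𝔘₁ for some (equivalently, any) reduced word (j_1,…,j_ν) of w₀. -/

import Mathlib

open FreeMonoid

/-- The minimum of two elements of an additive subgroup of `ℝ`
(the "sum" in the tropical semifield `K`). -/
noncomputable def kmin {K : AddSubgroup ℝ} (a b : K) : K :=
  if (a : ℝ) ≤ (b : ℝ) then a else b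

/-- Defining relations of the monoid `𝔘(K)` attached to a simply laced Coxeter matrix `M`
and the tropical semifield `K` (a subgroup of `(ℝ, +)` with sum `min` and product `+`). -/
inductive UKRel {I : Type*} (M : CoxeterMatrix I) (K : AddSubgroup ℝ) :
    FreeMonoid (I × K) → FreeMonoid (I × K) → Prop
  | comm (i j : I) (h : M i j = 2) (a b : K) :
      UKRel M K (of (i, a) * of (j, b)) (of (j, b) * of (i, a))
  | braid (i j : I) (h : M i j = 3) (a b c : K) :
      UKRel M K (of (i, a) * of (j, b) * of (i, c))
        (of (j, b + c - kmin a c) * of (i, kmin a c) * of (j, a + b - kmin a c))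
  | idem (i : I) (a b : K) :
      UKRel M K (of (i, a) * of (i, b)) (of (i, kmin a b))

/-- The monoid `𝔘(K)`. -/
noncomputable def UK {I : Type*} (M : CoxeterMatrix I) (K : AddSubgroup ℝ) :=
  (conGen (UKRel M K)).Quotient

noncomputable instance {I : Type*} (M : CoxeterMatrix I) (K : AddSubgroup ℝ) :
    Monoid (UK M K) := Con.monoid _

/-- The generator `i^a` of `𝔘(K)`. -/
noncomputable def genU {I : Type*} (M : CoxeterMatrix I) (K : AddSubgroup ℝ)
    (i : I) (a : K) : UK M K :=
  (Con.mk' _) (of (i, a))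

/-- The product `i₁^{a₁} ⋯ i_n^{a_n}` in `𝔘(K)` associated to a list of pairs. -/
noncomputable def prodU {I : Type*} (M : CoxeterMatrix I) (K : AddSubgroup ℝ)
    (ω : List (I × K)) : UK M K :=
  (ω.map fun p => genU M K p.1 p.2).prod

/-- `l` is a reduced word of `w`. -/
def IsRedWord {I W : Type*} [Group W] {M : CoxeterMatrix I} (cs : CoxeterSystem M W)
    (w : W) (l : List I) : Prop :=
  cs.wordProd l = w ∧ l.length = cs.length w

/-- The set `𝒰(K) = 𝔘_{w₀}(K)` of products over reduced words of `w₀`. -/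
noncomputable def calU {I W : Type*} [Group W] (M : CoxeterMatrix I) (K : AddSubgroup ℝ)
    (cs : CoxeterSystem M W) (w₀ : W) : Set (UK M K) :=
  {u | ∃ ω : List (I × K), IsRedWord cs w₀ (ω.map Prod.fst) ∧ u = prodU M K ω}

/-- The set `𝒰(K₊)`: products over reduced words of `w₀` with coefficients in `K₊ = K ∩ ℝ≥0`. -/
noncomputable def calUplus {I W : Type*} [Group W] (M : CoxeterMatrix I) (K : AddSubgroup ℝ)
    (cs : CoxeterSystem M W) (w₀ : W) : Set (UK M K) :=
  {u | ∃ ω : List (I × K), IsRedWord cs w₀ (ω.map Prod.fst) ∧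
        (∀ p ∈ ω, 0 ≤ (p.2 : ℝ)) ∧ u = prodU M K ω}

/-- Two vertices of the graph on `𝒰(K)` are joined by an edge. -/
noncomputable def UEdge {I W : Type*} [Group W] (M : CoxeterMatrix I) (K : AddSubgroup ℝ)
    (cs : CoxeterSystem M W) (w₀ : W) (H H' : UK M K) : Prop :=
  H ≠ H' ∧ ∃ (i : I) (b b' : K) (ω : List (I × K)),
    IsRedWord cs w₀ (i :: ω.map Prod.fst) ∧
    H = genU M K i b * prodU M K ω ∧ H' = genU M K i b' * prodU M K ω

/-- `H` and `H'` are at distance `≤ k` in the graph on `𝒰(K)`. -/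
noncomputable def DistLE {I W : Type*} [Group W] (M : CoxeterMatrix I) (K : AddSubgroup ℝ)
    (cs : CoxeterSystem M W) (w₀ : W) (k : ℕ) (H H' : UK M K) : Prop :=
  ∃ f : ℕ → UK M K, f 0 = H ∧ f k = H' ∧ (∀ t ≤ k, f t ∈ calU M K cs w₀) ∧
    ∀ t < k, f t = f (t + 1) ∨ UEdge M K cs w₀ (f t) (f (t + 1))

/-- Defining relations of the 0-Hecke monoid `𝔘₁` of a simply laced Coxeter matrix. -/
inductive HeckeRel {I : Type*} (M : CoxeterMatrix I) : FreeMonoid I → FreeMonoid I → Prop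
  | comm (i j : I) (h : M i j = 2) : HeckeRel M (of i * of j) (of j * of i)
  | braid (i j : I) (h : M i j = 3) : HeckeRel M (of i * of j * of i) (of j * of i * of j)
  | idem (i : I) : HeckeRel M (of i * of i) (of i)

/-- The 0-Hecke monoid `𝔘₁ = 𝔘({1})`. -/
def Hecke {I : Type*} (M : CoxeterMatrix I) := (conGen (HeckeRel M)).Quotient

instance {I : Type*} (M : CoxeterMatrix I) : Monoid (Hecke M) := Con.monoid _

/-- The generator `g_i` of the 0-Hecke monoid. -/
def genH {I : Type*} (M : CoxeterMatrix I) (i : I) : Hecke M := (Con.mk' _) (of i)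

/-- The product `g_{i₁} g_{i₂} ⋯ g_{i_n}` in the 0-Hecke monoid. -/
def prodH {I : Type*} (M : CoxeterMatrix I) (l : List I) : Hecke M :=
  (l.map fun i => genH M i).prod

/-- The list of indices (in order) whose coefficient vanishes, in a word in the
generators of `𝔘(K)`. -/
noncomputable def zeroList {I : Type*} {K : AddSubgroup ℝ} : List (I × K) → List I
  | [] => []
  | p :: rest => if (p.2 : ℝ) = 0 then p.1 :: zeroList rest else zeroList rest

/-- The zero-subword of a representation `i₁^{a₁} ⋯ i_n^{a_n}`, as an element of the
0-Hecke monoid `𝔘₁`: the product `g_{i_{j₁}} ⋯ g_{i_{j_k}}` over the positions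
`j₁ < ⋯ < j_k` where `a_j = 0`. -/
noncomputable def chiRep {I : Type*} (M : CoxeterMatrix I) {K : AddSubgroup ℝ}
    (ω : List (I × K)) : Hecke M :=
  prodH M (zeroList ω)

theorem Function.End.mul_eval {α : Type*} (f g : Function.End α) (x : α) :
    (f * g) x = f (g x) := rfl

namespace CoxeterSystem

variable {I W : Type*} [Group W] {M : CoxeterMatrix I}

theorem isLiftable_of_simplyLaced {G : Type*} [Monoid G]
    (hM : ∀ i j : I, i ≠ j → M i j = 2 ∨ M i j = 3) {f : I → G}
    (hsq : ∀ i, f i * f i = 1)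
    (hcomm : ∀ i j, M i j = 2 → f i * f j = f j * f i)
    (hbraid : ∀ i j, M i j = 3 → f i * f j * f i = f j * f i * f j) :
    M.IsLiftable f := by
  intro i j
  by_cases hij : i = j
  · subst hij
    rw [M.diagonal, pow_one, hsq]
  rcases hM i j hij with h | h
  · rw [h, pow_two]
    nth_rewrite 2 [hcomm i j h]
    rw [mul_assoc, ← mul_assoc (f j), hsq, one_mul, hsq]
  · rw [h]
    calc (f i * f j) ^ 3 = f i * f j * f i * (f j * f i * f j) := by
          simp only [pow_succ, pow_zero, one_mul, mul_assoc]
      _ = f i * f j * f i * (f i * f j * f i) := by rw [hbraid i j h]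
      _ = f i * (f j * (f i * f i) * f j) * f i := by simp only [mul_assoc]
      _ = 1 := by simp [hsq]

theorem simple_mul_comm (cs : CoxeterSystem M W) {i j : I} (h : M i j = 2) :
    cs.simple i * cs.simple j = cs.simple j * cs.simple i := by
  have := cs.simple_mul_simple_pow i j
  rw [h, pow_two] at this
  simpa using eq_inv_of_mul_eq_one_left this

theorem simple_braid (cs : CoxeterSystem M W) {i j : I} (h : M i j = 3) :
    cs.simple i * cs.simple j * cs.simple i = cs.simple j * cs.simple i * cs.simple j := by
  have := cs.simple_mul_simple_pow i j
  rw [h] at this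
  have h' : cs.simple i * cs.simple j * cs.simple i *
      (cs.simple j * cs.simple i * cs.simple j) = 1 := by
    rw [← this]; simp only [pow_succ, pow_zero, one_mul, mul_assoc]
  simpa [mul_assoc] using eq_inv_of_mul_eq_one_left h'

/-- The simple reflection at `i` on integer functions on a simply laced Coxeter graph: the value
at `i` changes sign after being added to each neighbour (the move of Mozes's numbers game). -/
noncomputable def numbersMove (M : CoxeterMatrix I) (i : I) : Function.End (I → ℤ) := fun x k =>
  open Classical in
  if k = i then -x i else if M i k = 3 then x k + x i else x k

theorem simple_injective (cs : CoxeterSystem M W)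
    (hM : ∀ i j : I, i ≠ j → M i j = 2 ∨ M i j = 3) : Function.Injective cs.simple := by
  have hlift : M.IsLiftable (numbersMove M) := by
    refine isLiftable_of_simplyLaced hM ?_ ?_ ?_
    · intro i
      funext x k
      have := M.diagonal i
      simp only [Function.End.mul_eval, Function.End.one_def, numbersMove, id]
      grind
    · intro i j h
      funext x k
      have := M.symmetric i j
      have := M.diagonal i
      simp only [Function.End.mul_eval, numbersMove]
      grind
    · intro i j h
      funext x k
      have := M.symmetric i j
      have := M.diagonal i
      simp only [Function.End.mul_eval, numbersMove]
      grind
  intro i j hij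
  by_contra hne
  have key : numbersMove M i = numbersMove M j := by
    rw [← cs.lift_apply_simple hlift i, ← cs.lift_apply_simple hlift j, hij]
  classical
  have := congrFun (congrFun key (Pi.single i 1)) i
  simp [numbersMove, hne] at this

open Classical in
/-- The signed permutation of `W × {±1}` by which the simple reflection at `i` acts. -/
noncomputable def signedConj (cs : CoxeterSystem M W) (i : I) : Function.End (W × ZMod 2) :=
  fun p => (cs.simple i * p.1 * cs.simple i, p.2 + if p.1 = cs.simple i then 1 else 0)

theorem signedConj_isLiftable (cs : CoxeterSystem M W)
    (hM : ∀ i j : I, i ≠ j → M i j = 2 ∨ M i j = 3) : M.IsLiftable cs.signedConj := by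
  classical
  have h2 : (1 + 1 : ZMod 2) = 0 := by decide
  have conj_eq (i : I) (t x : W) : cs.simple i * t * cs.simple i = x ↔
      t = cs.simple i * x * cs.simple i := by
    constructor <;> rintro rfl <;> simp [mul_assoc]
  refine isLiftable_of_simplyLaced hM ?_ ?_ ?_
  · rintro i
    funext ⟨t, e⟩
    simp only [Function.End.mul_eval, Function.End.one_def, signedConj, id, conj_eq]
    refine Prod.ext (by simp [mul_assoc]) ?_
    by_cases h : t = cs.simple i <;> simp [h, add_assoc, h2]
  · rintro i j h
    have hc := cs.simple_mul_comm h
    funext ⟨t, e⟩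
    simp only [Function.End.mul_eval, signedConj, conj_eq]
    refine Prod.ext ?_ ?_
    · calc cs.simple i * (cs.simple j * t * cs.simple j) * cs.simple i
          = (cs.simple i * cs.simple j) * t * (cs.simple j * cs.simple i) := by
            simp only [mul_assoc]
        _ = (cs.simple j * cs.simple i) * t * (cs.simple i * cs.simple j) := by rw [hc]
        _ = _ := by simp only [mul_assoc]
    · have e1 : cs.simple j * cs.simple i * cs.simple j = cs.simple i := by rw [← hc]; simp
      have e2 : cs.simple i * cs.simple j * cs.simple i = cs.simple j := by rw [hc]; simp
      simp only [e1, e2]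
      ring
  · rintro i j h
    have hb := cs.simple_braid h
    funext ⟨t, e⟩
    simp only [Function.End.mul_eval, signedConj, conj_eq]
    refine Prod.ext ?_ ?_
    · calc _ = (cs.simple i * cs.simple j * cs.simple i) * t *
            (cs.simple i * cs.simple j * cs.simple i) := by simp only [mul_assoc]
        _ = (cs.simple j * cs.simple i * cs.simple j) * t *
            (cs.simple j * cs.simple i * cs.simple j) := by rw [hb]
        _ = _ := by simp only [mul_assoc]
    · have e1 : cs.simple i * (cs.simple j * cs.simple i * cs.simple j) * cs.simple i
          = cs.simple j := by rw [← hb]; simp [mul_assoc]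
      have e2 : cs.simple j * (cs.simple j * cs.simple i * cs.simple j) * cs.simple j
          = cs.simple i := by simp [mul_assoc]
      simp only [hb, e1, e2]
      ring

open Classical in
theorem count_rightInvSeq_eq_of_wordProd_eq (cs : CoxeterSystem M W)
    (hM : ∀ i j : I, i ≠ j → M i j = 2 ∨ M i j = 3) {l l' : List I}
    (h : cs.wordProd l = cs.wordProd l') (t : W) :
    ((cs.rightInvSeq l).count t : ZMod 2) = (cs.rightInvSeq l').count t := by
  have key (l : List I) (e : ZMod 2) :
      cs.lift ⟨_, cs.signedConj_isLiftable hM⟩ (cs.wordProd l) (t, e) =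
        (cs.wordProd l * t * (cs.wordProd l)⁻¹, e + (cs.rightInvSeq l).count t) := by
    induction l with
    | nil => simp [Function.End.one_def]
    | cons i l ih =>
      rw [wordProd_cons, map_mul, lift_apply_simple, Function.End.mul_eval, ih,
        signedConj, rightInvSeq, List.count_cons]
      refine Prod.ext (by simp [mul_assoc]) ?_
      have : cs.wordProd l * t * (cs.wordProd l)⁻¹ = cs.simple i ↔
          ((cs.wordProd l)⁻¹ * cs.simple i * cs.wordProd l == t) = true := by
        rw [beq_iff_eq]
        constructor
        · intro h; rw [← h]; group
        · rintro rfl; group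
      simp only [this]
      push_cast
      ring
  have := (key l 0).symm.trans ((congrArg (fun w => cs.lift ⟨_, cs.signedConj_isLiftable hM⟩ w
    (t, 0)) h).trans (key l' 0))
  simpa using (Prod.ext_iff.1 this).2

/-- The exchange property: a left descent of a reduced word can be moved to its front by deleting
one letter. -/
theorem exists_wordProd_cons_eraseIdx (cs : CoxeterSystem M W)
    (hM : ∀ i j : I, i ≠ j → M i j = 2 ∨ M i j = 3) {j : I} {l l' : List I}
    (hl : cs.IsReduced (j :: l)) (h : cs.wordProd (j :: l) = cs.wordProd l') :
    ∃ k < l'.length, cs.wordProd l = cs.wordProd (l'.eraseIdx k) := by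
  classical
  have hrev (m : List I) : cs.wordProd m.reverse = (cs.wordProd m)⁻¹ := cs.wordProd_reverse m
  have hcount := cs.count_rightInvSeq_eq_of_wordProd_eq hM
    (l := (j :: l).reverse) (l' := l'.reverse) (by rw [hrev, hrev, h]) (cs.simple j)
  have hmem : cs.simple j ∈ cs.leftInvSeq (j :: l) := by simp [leftInvSeq]
  have hone := List.count_eq_one_of_mem hl.nodup_leftInvSeq hmem
  simp only [rightInvSeq_reverse, List.count_reverse, hone] at hcount
  have hmem' : cs.simple j ∈ cs.leftInvSeq l' := by
    by_contra hn
    rw [List.count_eq_zero_of_not_mem hn] at hcount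
    exact absurd hcount (by decide)
  obtain ⟨k, hk, hkj⟩ := List.getElem_of_mem hmem'
  refine ⟨k, by simpa using hk, ?_⟩
  have := cs.getD_leftInvSeq_mul_wordProd l' k
  rw [List.getD_eq_getElem _ _ hk, hkj, ← h, wordProd_cons, simple_mul_simple_cancel_left] at this
  exact this

theorem IsReduced.tail {cs : CoxeterSystem M W} {i : I} {l : List I}
    (h : cs.IsReduced (i :: l)) : cs.IsReduced l := by
  simpa using h.drop 1

theorem isReduced_of_wordProd_eq {cs : CoxeterSystem M W} {l l' : List I} (hl : cs.IsReduced l)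
    (h : cs.wordProd l = cs.wordProd l') (hlen : l'.length = l.length) : cs.IsReduced l' := by
  rw [IsReduced, ← h, hl.eq, hlen]

/-- Matsumoto's theorem for simply laced Coxeter groups. -/
theorem prod_map_eq_of_isReduced (cs : CoxeterSystem M W)
    (hM : ∀ i j : I, i ≠ j → M i j = 2 ∨ M i j = 3) {G : Type*} [Monoid G] {f : I → G}
    (hcomm : ∀ i j, M i j = 2 → f i * f j = f j * f i)
    (hbraid : ∀ i j, M i j = 3 → f i * f j * f i = f j * f i * f j) {l l' : List I}
    (hl : cs.IsReduced l) (hl' : cs.IsReduced l') (h : cs.wordProd l = cs.wordProd l') :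
    (l.map f).prod = (l'.map f).prod := by
  have hlen : l.length = l'.length := by rw [← hl.eq, ← hl'.eq, h]
  induction hn : l.length using Nat.strong_induction_on generalizing l l' with
  | _ n ih =>
  have same_head {i : I} {t t' : List I} (ht : cs.IsReduced (i :: t))
      (ht' : cs.IsReduced (i :: t')) (he : cs.wordProd (i :: t) = cs.wordProd (i :: t'))
      (hlt : (i :: t).length = n) : ((i :: t).map f).prod = ((i :: t').map f).prod := by
    have he' : cs.wordProd t = cs.wordProd t' := by
      simpa [wordProd_cons] using he
    have hlt' : t.length = t'.length := by rw [← ht.tail.eq, ← ht'.tail.eq, he']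
    rw [List.map_cons, List.prod_cons, List.map_cons, List.prod_cons,
      ih t.length (by simp at hlt; omega) ht.tail ht'.tail he' hlt' rfl]
  match l, l' with
  | [], [] => rfl
  | [], _ :: _ => simp at hlen
  | _ :: _, [] => simp at hlen
  | i :: t, j :: t' =>
  by_cases hij : i = j
  · subst hij
    exact same_head hl hl' h hn
  have hs : cs.simple i ≠ cs.simple j := fun e => hij (cs.simple_injective hM e)
  obtain ⟨k, hk, hexch⟩ := cs.exists_wordProd_cons_eraseIdx hM hl' h.symm
  match k with
  | 0 =>
    rw [wordProd_cons, wordProd_cons, hexch] at h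
    exact absurd (mul_right_cancel h) hs
  | k + 1 =>
  rw [List.eraseIdx_cons_succ] at hexch
  have hk' : k < t.length := by simpa using hk
  have hulen := List.length_eraseIdx_add_one hk'
  generalize t.eraseIdx k = u at hexch hulen
  have hw : cs.wordProd (i :: t) = cs.wordProd (j :: i :: u) := by
    rw [h, wordProd_cons, hexch, ← wordProd_cons]
  have hlu : (j :: i :: u).length = (i :: t).length := by simp [hulen]
  have hju : cs.IsReduced (j :: i :: u) := isReduced_of_wordProd_eq hl hw hlu
  have right := same_head hju hl' (hw.symm.trans h) (hlu.trans hn)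
  rcases hM i j hij with hm | hm
  · have hc := cs.simple_mul_comm hm
    have hw' : cs.wordProd (i :: t) = cs.wordProd (i :: j :: u) := by
      rw [hw]; simp only [wordProd_cons, ← mul_assoc, hc]
    have hiu : cs.IsReduced (i :: j :: u) := isReduced_of_wordProd_eq hl hw' (by simpa using hlu)
    rw [same_head hl hiu hw' hn, ← right]
    simp only [List.map_cons, List.prod_cons, ← mul_assoc, hcomm i j hm]
  · obtain ⟨k, hk, hexch⟩ := cs.exists_wordProd_cons_eraseIdx hM hl hw
    match k with
    | 0 =>
      rw [List.eraseIdx_cons_zero] at hexch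
      rw [wordProd_cons, hexch, wordProd_cons, simple_mul_simple_cancel_left] at hw
      have h1 := hju.eq
      rw [← hw, hju.tail.tail.eq] at h1
      simp only [List.length_cons] at h1
      omega
    | 1 =>
      simp only [List.eraseIdx_cons_succ, List.eraseIdx_cons_zero] at hexch
      rw [wordProd_cons, hexch] at hw
      simp only [wordProd_cons, ← mul_assoc] at hw
      have hc := mul_right_cancel hw
      have hb := cs.simple_braid hm
      rw [hc] at hb
      exact absurd (mul_left_cancel hb) hs
    | k + 2 =>
    simp only [List.eraseIdx_cons_succ] at hexch
    have hk' : k < u.length := by simpa using hk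
    have hvlen := List.length_eraseIdx_add_one hk'
    generalize u.eraseIdx k = v at hexch hvlen
    have hw₁ : cs.wordProd (i :: t) = cs.wordProd (i :: j :: i :: v) := by
      rw [wordProd_cons, hexch, ← wordProd_cons]
    have hw₂ : cs.wordProd (i :: t) = cs.wordProd (j :: i :: j :: v) := by
      rw [hw₁]; simp only [wordProd_cons, ← mul_assoc, cs.simple_braid hm]
    have hr₁ : cs.IsReduced (i :: j :: i :: v) := isReduced_of_wordProd_eq hl hw₁ (by simp; omega)
    have hr₂ : cs.IsReduced (j :: i :: j :: v) := isReduced_of_wordProd_eq hl hw₂ (by simp; omega)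
    rw [same_head hl hr₁ hw₁ hn, ← same_head hr₂ hl' (hw₂.symm.trans h) (by simp at hn ⊢; omega)]
    simp only [List.map_cons, List.prod_cons, ← mul_assoc, hbraid i j hm]

end CoxeterSystem

open Pointwise in
/-- The homomorphism from the 0-Hecke monoid to subsets of `W` whose value on a product of
generators is the set of products of its subwords. -/
noncomputable def subwordHom {I W : Type*} [Group W] {M : CoxeterMatrix I}
    (cs : CoxeterSystem M W) : Hecke M →* Set W :=
  Con.lift _ (FreeMonoid.lift fun i => {1, cs.simple i}) <| Con.conGen_le.2 <| by
    intro x y h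
    rw [Con.ker_rel]
    cases h with
    | comm i j h =>
      have hc := cs.simple_mul_comm h
      ext w
      simp [Set.mem_mul, hc]
      tauto
    | braid i j h =>
      have hb := cs.simple_braid h
      ext w
      simp [Set.mem_mul, hb, or_and_right, exists_or]
      tauto
    | idem i =>
      ext w
      simp [Set.mem_mul]
      tauto

open Pointwise in
theorem subwordHom_prodH {I W : Type*} [Group W] {M : CoxeterMatrix I}
    (cs : CoxeterSystem M W) (l : List I) :
    subwordHom cs (prodH M l) = (l.map fun i => ({1, cs.simple i} : Set W)).prod := by
  rw [prodH, map_list_prod, List.map_map]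
  rfl

theorem length_le_of_prodH_eq {I W : Type*} [Group W] {M : CoxeterMatrix I}
    (cs : CoxeterSystem M W) {l l' : List I} (h : prodH M l = prodH M l') :
    cs.length (cs.wordProd l') ≤ l.length := by
  open Pointwise in
  have hmem (l : List I) : cs.wordProd l ∈ (l.map fun i => ({1, cs.simple i} : Set W)).prod := by
    induction l with
    | nil => simp
    | cons i l ih =>
      rw [cs.wordProd_cons, List.map_cons, List.prod_cons]
      exact Set.mul_mem_mul (by simp) ih
  have hle (l : List I) (w : W) (hw : w ∈ (l.map fun i => ({1, cs.simple i} : Set W)).prod) :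
      cs.length w ≤ l.length := by
    induction l generalizing w with
    | nil => simp_all
    | cons i l ih =>
      rw [List.map_cons, List.prod_cons] at hw
      obtain ⟨x, hx, y, hy, rfl⟩ := Set.mem_mul.1 hw
      have := ih y hy
      have := cs.length_mul_le x y
      rcases hx with rfl | rfl
      · simp; omega
      · rw [cs.length_simple] at this
        simp; omega
  apply hle
  rw [← subwordHom_prodH, h, subwordHom_prodH]
  exact hmem l'

open Classical in
/-- The function of a real exponent equal to `0` at negative numbers, to `g` at `0` and to `1` at
positive numbers. -/
noncomputable def signVal {N : Type*} [MonoidWithZero N] (g : N) (x : ℝ) : N :=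
  if x < 0 then 0 else if x = 0 then g else 1

section signVal

variable {N : Type*} [MonoidWithZero N] (g h : N)

theorem signVal_of_neg {x : ℝ} (hx : x < 0) : signVal g x = 0 := if_pos hx

@[simp] theorem signVal_zero : signVal g 0 = g := by simp [signVal]

theorem signVal_of_pos {x : ℝ} (hx : 0 < x) : signVal g x = 1 := by
  simp [signVal, hx.not_gt, hx.ne']

variable {g h}

theorem signVal_mul_comm (hgh : g * h = h * g) (a b : ℝ) :
    signVal g a * signVal h b = signVal h b * signVal g a := by
  unfold signVal
  split_ifs <;> simp [hgh]

theorem signVal_idem_of_le (hg : g * g = g) {a b : ℝ} (hab : a ≤ b) :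
    signVal g a * signVal g b = signVal g a ∧ signVal g b * signVal g a = signVal g a := by
  unfold signVal
  split_ifs <;> first | (exfalso; grind) | simp [hg]

theorem signVal_idem (hg : g * g = g) (a b : ℝ) :
    signVal g a * signVal g b = signVal g (min a b) := by
  rcases le_total a b with hab | hab
  · rw [min_eq_left hab, (signVal_idem_of_le hg hab).1]
  · rw [min_eq_right hab, (signVal_idem_of_le hg hab).2]

theorem signVal_braid (hgh : g * h * g = h * g * h) (hg : g * g = g) (hh : h * h = h)
    (a b c : ℝ) : signVal g a * signVal h b * signVal g c =
      signVal h (b + c - min a c) * signVal g (min a c) * signVal h (a + b - min a c) := by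
  rcases lt_trichotomy b 0 with hb | rfl | hb
  · rcases le_total a c with hac | hac
    · simp [hac, signVal_of_neg _ hb]
    · simp [hac, signVal_of_neg _ hb]
  · rcases lt_trichotomy a c with hac | rfl | hac
    · have h1 := signVal_of_pos h (sub_pos.2 hac)
      rcases lt_trichotomy a 0 with ha | rfl | ha
      · simp [hac.le, signVal_of_neg _ ha]
      · simp [hac.le, signVal_of_pos _ hac]
      · simp [hac.le, signVal_of_pos _ ha, signVal_of_pos _ (ha.trans hac), h1]
    · rcases lt_trichotomy a 0 with ha | rfl | ha
      · simp [signVal_of_neg _ ha]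
      · simp [hgh]
      · simp [signVal_of_pos _ ha, hh]
    · have h1 := signVal_of_pos h (sub_pos.2 hac)
      rcases lt_trichotomy c 0 with hc | rfl | hc
      · simp [hac.le, signVal_of_neg _ hc]
      · simp [hac.le, signVal_of_pos _ hac]
      · simp [hac.le, signVal_of_pos _ hc, signVal_of_pos _ (hc.trans hac), h1]
  · have h1 : 0 < b + c - min a c := by linarith [min_le_right a c]
    have h2 : 0 < a + b - min a c := by linarith [min_le_left a c]
    rw [signVal_of_pos _ hb, signVal_of_pos _ h1, signVal_of_pos _ h2, mul_one, mul_one, one_mul,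
      signVal_idem hg]

end signVal

/-- The value on a generator of `𝔘(K)` of the map extending `χ` by zero outside `𝔘(K₊)`. -/
noncomputable def chiGen {I : Type*} (M : CoxeterMatrix I) {K : AddSubgroup ℝ} (p : I × K) :
    WithZero (Hecke M) :=
  signVal (genH M p.1 : WithZero (Hecke M)) p.2

theorem genH_mul_self {I : Type*} (M : CoxeterMatrix I) (i : I) :
    genH M i * genH M i = genH M i :=
  (Con.eq _).2 (ConGen.Rel.of _ _ (HeckeRel.idem i))

theorem genH_mul_comm {I : Type*} {M : CoxeterMatrix I} {i j : I} (h : M i j = 2) :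
    genH M i * genH M j = genH M j * genH M i :=
  (Con.eq _).2 (ConGen.Rel.of _ _ (HeckeRel.comm i j h))

theorem genH_braid {I : Type*} {M : CoxeterMatrix I} {i j : I} (h : M i j = 3) :
    genH M i * genH M j * genH M i = genH M j * genH M i * genH M j :=
  (Con.eq _).2 (ConGen.Rel.of _ _ (HeckeRel.braid i j h))

theorem genU_mul_comm {I : Type*} {M : CoxeterMatrix I} {K : AddSubgroup ℝ} {i j : I}
    (h : M i j = 2) (a b : K) : genU M K i a * genU M K j b = genU M K j b * genU M K i a :=
  (Con.eq _).2 (ConGen.Rel.of _ _ (UKRel.comm i j h a b))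

theorem genU_braid {I : Type*} {M : CoxeterMatrix I} {K : AddSubgroup ℝ} {i j : I}
    (h : M i j = 3) (a b c : K) : genU M K i a * genU M K j b * genU M K i c =
      genU M K j (b + c - kmin a c) * genU M K i (kmin a c) * genU M K j (a + b - kmin a c) :=
  (Con.eq _).2 (ConGen.Rel.of _ _ (UKRel.braid i j h a b c))

theorem coe_kmin {K : AddSubgroup ℝ} (a b : K) : (kmin a b : ℝ) = min (a : ℝ) b := by
  unfold kmin
  split_ifs with h
  · rw [min_eq_left h]
  · rw [min_eq_right (le_of_not_ge h)]

/-- The monoid homomorphism extending `χ` by zero outside `𝔘(K₊)`. -/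
noncomputable def chiHom {I : Type*} (M : CoxeterMatrix I) (K : AddSubgroup ℝ) :
    UK M K →* WithZero (Hecke M) :=
  Con.lift _ (FreeMonoid.lift (chiGen M)) <| Con.conGen_le.2 <| by
    intro x y h
    rw [Con.ker_rel]
    cases h with
    | comm i j h a b =>
      simp only [map_mul, FreeMonoid.lift_eval_of, chiGen]
      exact signVal_mul_comm (by simp only [← WithZero.coe_mul, genH_mul_comm h]) _ _
    | braid i j h a b c =>
      simp only [map_mul, FreeMonoid.lift_eval_of, chiGen]
      push_cast [coe_kmin]
      exact signVal_braid (by simp only [← WithZero.coe_mul, genH_braid h])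
        (by rw [← WithZero.coe_mul, genH_mul_self]) (by rw [← WithZero.coe_mul, genH_mul_self])
        _ _ _
    | idem i a b =>
      simp only [map_mul, FreeMonoid.lift_eval_of, chiGen]
      rw [coe_kmin]
      exact signVal_idem (by rw [← WithZero.coe_mul, genH_mul_self]) _ _

theorem chiHom_prodU {I : Type*} {M : CoxeterMatrix I} {K : AddSubgroup ℝ} {ω : List (I × K)}
    (hω : ∀ p ∈ ω, 0 ≤ (p.2 : ℝ)) : chiHom M K (prodU M K ω) = (chiRep M ω : Hecke M) := by
  induction ω with
  | nil => exact map_one _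
  | cons p ω ih =>
    have hp : chiHom M K (genU M K p.1 p.2) = chiGen M p := rfl
    have ih' := ih fun q hq => hω q (List.mem_cons_of_mem _ hq)
    have h0 := hω p List.mem_cons_self
    rw [prodU, List.map_cons, List.prod_cons, map_mul, ← prodU, ih', hp, chiGen,
      chiRep, chiRep, zeroList, signVal, if_neg (not_lt.2 h0)]
    split_ifs
    · rw [← WithZero.coe_mul, prodH, prodH, List.map_cons, List.prod_cons]
    · rw [one_mul]

theorem zeroList_map_zero {I : Type*} {K : AddSubgroup ℝ} (l : List I) :
    zeroList (l.map fun i => (i, (0 : K))) = l := by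
  induction l with
  | nil => rfl
  | cons i l ih => simp [zeroList, ih]

theorem length_zeroList_le {I : Type*} {K : AddSubgroup ℝ} (ω : List (I × K)) :
    (zeroList ω).length ≤ ω.length := by
  induction ω with
  | nil => simp [zeroList]
  | cons p ω ih =>
    rw [zeroList]
    split_ifs <;> simp <;> omega

theorem eq_map_zero_of_length_le {I : Type*} {K : AddSubgroup ℝ} {ω : List (I × K)}
    (h : ω.length ≤ (zeroList ω).length) :
    ω = (ω.map Prod.fst).map fun i => (i, (0 : K)) := by
  induction ω with
  | nil => rfl
  | cons p ω ih =>
    have hle := length_zeroList_le ω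
    rw [zeroList] at h
    split_ifs at h with hp
    · rw [List.map_cons, List.map_cons, ← ih (by simpa using h)]
      exact congrArg (· :: ω) (Prod.ext rfl (Subtype.ext hp))
    · simp at h
      omega

theorem IsRedWord.isReduced {I W : Type*} [Group W] {M : CoxeterMatrix I}
    {cs : CoxeterSystem M W} {w : W} {l : List I} (h : IsRedWord cs w l) : cs.IsReduced l := by
  rw [CoxeterSystem.IsReduced, h.1, h.2]

theorem prodU_map_zero_eq {I W : Type*} [Group W] {M : CoxeterMatrix I}
    (hM : ∀ i j : I, i ≠ j → M i j = 2 ∨ M i j = 3) (cs : CoxeterSystem M W)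
    (K : AddSubgroup ℝ) {w : W} {l l' : List I} (hl : IsRedWord cs w l)
    (hl' : IsRedWord cs w l') :
    prodU M K (l.map fun i => (i, (0 : K))) = prodU M K (l'.map fun i => (i, (0 : K))) := by
  have hmin : kmin (0 : K) 0 = 0 := if_pos le_rfl
  have := cs.prod_map_eq_of_isReduced hM (f := fun i => genU M K i 0)
    (fun i j h => genU_mul_comm h 0 0)
    (fun i j h => by simpa [hmin] using genU_braid h (0 : K) 0 0)
    hl.isReduced hl'.isReduced (hl.1.trans hl'.1.symm)
  rwa [prodU, prodU, List.map_map, List.map_map]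

theorem prodH_eq {I W : Type*} [Group W] {M : CoxeterMatrix I}
    (hM : ∀ i j : I, i ≠ j → M i j = 2 ∨ M i j = 3) (cs : CoxeterSystem M W)
    {w : W} {l l' : List I} (hl : IsRedWord cs w l) (hl' : IsRedWord cs w l') :
    prodH M l = prodH M l' :=
  cs.prod_map_eq_of_isReduced hM (f := genH M) (fun _ _ => genH_mul_comm)
    (fun _ _ => genH_braid) hl.isReduced hl'.isReduced (hl.1.trans hl'.1.symm)

/-- A nonnegative representation over a reduced word of `w` has maximal zero-subword only if all
its coefficients vanish. -/
theorem eq_map_zero_of_chiRep_eq {I W : Type*} [Group W] {M : CoxeterMatrix I}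
    (cs : CoxeterSystem M W) {K : AddSubgroup ℝ} {w : W} {ω : List (I × K)} {l : List I}
    (hω : IsRedWord cs w (ω.map Prod.fst)) (hl : IsRedWord cs w l)
    (h : chiRep M ω = prodH M l) : ω = (ω.map Prod.fst).map fun i => (i, (0 : K)) := by
  apply eq_map_zero_of_length_le
  have := length_le_of_prodH_eq cs h
  rwa [hl.1, ← hω.2, List.length_map] at this

/-- The zero-subword of any nonnegative representation of `i₁^0 ⋯ i_n^0`. -/
theorem chiRep_eq_of_prodU_eq {I : Type*} {M : CoxeterMatrix I} {K : AddSubgroup ℝ}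
    {ω : List (I × K)} {l : List I} (hω : ∀ p ∈ ω, 0 ≤ (p.2 : ℝ))
    (h : prodU M K ω = prodU M K (l.map fun i => (i, (0 : K)))) : chiRep M ω = prodH M l := by
  have := congrArg (chiHom M K) h
  rw [chiHom_prodU hω, chiHom_prodU (by simp), WithZero.coe_inj] at this
  rw [this, chiRep, zeroList_map_zero]

/-- **9(b)** (Lusztig, "Half circles on flag manifolds over a semifield").
The element `𝐇 = i₁^0 i₂^0 ⋯ i_ν^0` of `𝒰(K₊)` is independent of the chosen reduced word
`(i₁, …, i_ν)` of `w₀`, and it is the unique `H ∈ 𝒰(K₊)` such that `χ_{w₀}(H)` is the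
product `g_{j₁} g_{j₂} ⋯ g_{j_ν}` in `𝔘₁` over some (equivalently, any) reduced word
`(j₁, …, j_ν)` of `w₀`.  (Here `χ_{w₀}(H) = x` is expressed by saying that the
zero-subword of every representation of `H` over a reduced word of `w₀` with
coefficients in `K₊` equals `x`.) -/
theorem HH_characterization
    {I W : Type*} [Finite I] [Nonempty I] [Group W] [Finite W]
    (M : CoxeterMatrix I) (hM : ∀ i j : I, i ≠ j → M i j = 2 ∨ M i j = 3)
    (cs : CoxeterSystem M W)
    (K : AddSubgroup ℝ) (hK : K ≠ ⊥)
    (ν : ℕ) (w₀ : W) (hw₀ : cs.length w₀ = ν) (hν : ∀ w : W, cs.length w ≤ ν)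
    (l₀ : List I) (hl₀ : IsRedWord cs w₀ l₀) :
    (∀ l : List I, IsRedWord cs w₀ l →
      prodU M K (l.map fun i => (i, (0 : K))) = prodU M K (l₀.map fun i => (i, (0 : K)))) ∧
    (∀ H ∈ calUplus M K cs w₀,
      ((∃ l : List I, IsRedWord cs w₀ l ∧
          ∀ ω : List (I × K), IsRedWord cs w₀ (ω.map Prod.fst) →
            (∀ p ∈ ω, 0 ≤ (p.2 : ℝ)) → H = prodU M K ω → chiRep M ω = prodH M l) ↔
        H = prodU M K (l₀.map fun i => (i, (0 : K)))) ∧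
      ((∀ l : List I, IsRedWord cs w₀ l →
          ∀ ω : List (I × K), IsRedWord cs w₀ (ω.map Prod.fst) →
            (∀ p ∈ ω, 0 ≤ (p.2 : ℝ)) → H = prodU M K ω → chiRep M ω = prodH M l) ↔
        H = prodU M K (l₀.map fun i => (i, (0 : K))))) := by
  have forward (H : UK M K) (hH : H ∈ calUplus M K cs w₀) (l : List I) (hl : IsRedWord cs w₀ l)
      (h : ∀ ω : List (I × K), IsRedWord cs w₀ (ω.map Prod.fst) →
        (∀ p ∈ ω, 0 ≤ (p.2 : ℝ)) → H = prodU M K ω → chiRep M ω = prodH M l) :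
      H = prodU M K (l₀.map fun i => (i, (0 : K))) := by
    obtain ⟨ω, hω, hpos, rfl⟩ := hH
    rw [eq_map_zero_of_chiRep_eq cs hω hl (h ω hω hpos rfl)]
    exact prodU_map_zero_eq hM cs K hω hl₀
  have backward (l : List I) (hl : IsRedWord cs w₀ l) (ω : List (I × K))
      (hpos : ∀ p ∈ ω, 0 ≤ (p.2 : ℝ))
      (h : prodU M K (l₀.map fun i => (i, (0 : K))) = prodU M K ω) : chiRep M ω = prodH M l :=
    (chiRep_eq_of_prodU_eq hpos h.symm).trans (prodH_eq hM cs hl₀ hl)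
  refine ⟨fun l hl => prodU_map_zero_eq hM cs K hl hl₀, fun H hH => ⟨⟨?_, ?_⟩, ⟨?_, ?_⟩⟩⟩
  · rintro ⟨l, hl, h⟩
    exact forward H hH l hl h
  · rintro rfl
    exact ⟨l₀, hl₀, fun ω _ hpos h => backward l₀ hl₀ ω hpos h⟩
  · intro h
    exact forward H hH l₀ hl₀ (h l₀ hl₀)
  · rintro rfl l hl ω - hpos h
    exact backward l hl ω hpos h
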